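/- arXiv:1906.07411 — 2 statements merged into one kernel-verified Lean document; each statement's English description precedes it below -/
import Mathlib

section
/- Let X be a nonempty set and let Φ be a mapping with domain X². The following conditions are equivalent: (1) there is a strongly rigid Ptolemaic metric d on X such that Φ is combinatorially similar to d; (2) there is a strongly rigid metric d on X such that Φ is combinatorially similar to d; (3) Φ is symmetric (Φ(x,y) = Φ(y,x) for all x,y ∈ X), |Φ(X²)| ≤ 𝔠 holds, where 𝔠 is the cardinality of the continuum, there is a₀ ∈ Φ(X²) such that Φ⁻¹(a₀) = Δ_X, where Δ_X = {⟨x,x⟩ : x ∈ X}, and, for all x, y, u, v ∈ X, the condition Φ(x,y) = Φ(u,v) ≠ a₀ implies (x = u and y = v) or (x = v and y = u). -/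
open Set

universe u v w z

def range2 {X : Type u} {A : Type w} (Φ : X → X → A) : Set A := {a | ∃ x y, Φ x y = a}

def fiber {X : Type u} {A : Type w} (Φ : X → X → A) (a : A) : Set (X × X) :=
  {p | Φ p.1 p.2 = a}

def fibers {X : Type u} {A : Type w} (Φ : X → X → A) : Set (Set (X × X)) :=
  {R | ∃ a ∈ range2 Φ, R = fiber Φ a}

def IsCoherent {X : Type u} {A : Type w} (Φ : X → X → A) (a₀ : A) : Prop :=
  Equivalence (fun x y => Φ x y = a₀) ∧
    ∀ x₁ x₂ x₃ x₄, Φ x₁ x₂ = a₀ → Φ x₃ x₄ = a₀ → Φ x₁ x₃ = Φ x₂ x₄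

def CombSim {X : Type u} {Y : Type v} {A : Type w} {B : Type z}
    (Φ : X → X → A) (Ψ : Y → Y → B) : Prop :=
  ∃ (g : Y → X) (f : A → B), Function.Bijective g ∧
    Set.BijOn f (range2 Φ) (range2 Ψ) ∧ ∀ x y, Ψ x y = f (Φ (g x) (g y))

def IsPseudometric {X : Type u} (d : X → X → ℝ) : Prop :=
  (∀ x y, 0 ≤ d x y) ∧ (∀ x y, d x y = d y x) ∧ (∀ x, d x x = 0) ∧
    ∀ x y z, d x y ≤ d x z + d z y

def IsPtolemaic {X : Type u} (d : X → X → ℝ) : Prop :=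
  ∀ x y zz t, d x y * d zz t ≤ d x zz * d y t + d x t * d y zz

def IsMetric {X : Type u} (d : X → X → ℝ) : Prop :=
  (∀ x y, 0 ≤ d x y) ∧ (∀ x y, d x y = 0 ↔ x = y) ∧ (∀ x y, d x y = d y x) ∧
    ∀ x y zz, d x y ≤ d x zz + d zz y

def IsStronglyRigidMetric {X : Type u} (d : X → X → ℝ) : Prop :=
  ∀ x y uu vv, d x y = d uu vv → d x y ≠ 0 →
    (x = uu ∧ y = vv) ∨ (x = vv ∧ y = uu)

theorem CombSim.exists_equiv {X : Type u} {Y : Type v} {A : Type w} {B : Type z}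
    {Φ : X → X → A} {Ψ : Y → Y → B} (h : CombSim Φ Ψ) :
    ∃ e : X ≃ Y, ∀ x y u v, Φ x y = Φ u v ↔ Ψ (e x) (e y) = Ψ (e u) (e v) := by
  obtain ⟨g, f, hg, hf, hΨ⟩ := h
  refine ⟨(Equiv.ofBijective g hg).symm, fun x y u v => ?_⟩
  have hr : ∀ x, g ((Equiv.ofBijective g hg).symm x) = x :=
    (Equiv.ofBijective g hg).apply_symm_apply
  rw [hΨ, hΨ, hr, hr, hr, hr]
  exact (hf.injOn.eq_iff ⟨x, y, rfl⟩ ⟨u, v, rfl⟩).symm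

theorem CombSim.mk_range2_le_continuum {X : Type u} {Y : Type v} {A : Type w}
    {Φ : X → X → A} {d : Y → Y → ℝ} (h : CombSim Φ d) :
    Cardinal.mk (range2 Φ) ≤ Cardinal.continuum := by
  obtain ⟨g, f, hg, hf, hd⟩ := h
  have hle : Cardinal.lift.{0} (Cardinal.mk (range2 Φ)) ≤ Cardinal.lift.{w} (Cardinal.mk ℝ) :=
    Cardinal.lift_mk_le'.2 ⟨⟨fun a => f a, hf.injOn.injective⟩⟩
  simpa [Cardinal.mk_real] using hle

/-- A set of cardinality at most the continuum injects into any nondegenerate open interval. -/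
theorem exists_injOn_mem_Ioo {A : Type w} {s : Set A}
    (hs : Cardinal.mk s ≤ Cardinal.continuum) {a b : ℝ} (hab : a < b) :
    ∃ f : A → ℝ, Set.InjOn f s ∧ ∀ x, f x ∈ Ioo a b := by
  classical
  have hle : Cardinal.lift.{0} (Cardinal.mk s) ≤ Cardinal.lift.{w} (Cardinal.mk (Ioo a b)) := by
    simpa [Cardinal.mk_Ioo_real hab] using hs
  obtain ⟨j⟩ := Cardinal.lift_mk_le'.1 hle
  obtain ⟨c, hc⟩ := exists_between hab
  refine ⟨fun x => if h : x ∈ s then j ⟨x, h⟩ else c, fun x hx y hy hxy => ?_, fun x => ?_⟩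
  · simp only [dif_pos hx, dif_pos hy] at hxy
    simpa using j.injective (Subtype.ext hxy)
  · dsimp only
    split_ifs
    · exact (j _).2
    · exact hc

theorem isMetric_of_mem_Icc {X : Type u} {d : X → X → ℝ} (h0 : ∀ x, d x x = 0)
    (hsymm : ∀ x y, d x y = d y x) (hd : ∀ x y, x ≠ y → d x y ∈ Icc 1 2) : IsMetric d := by
  have hpos : ∀ x y, 0 ≤ d x y := fun x y => by
    rcases eq_or_ne x y with rfl | h
    · exact (h0 x).ge
    · linarith [(hd x y h).1]
  refine ⟨hpos, fun x y => ⟨fun h => ?_, fun h => h ▸ h0 x⟩, hsymm, fun x y t => ?_⟩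
  · by_contra hxy
    linarith [(hd x y hxy).1]
  · rcases eq_or_ne x t with rfl | hxt
    · simp [h0]
    rcases eq_or_ne t y with rfl | hty
    · simp [h0]
    rcases eq_or_ne x y with rfl | hxy
    · linarith [h0 x, hpos x t, hpos t x]
    linarith [(hd x y hxy).2, (hd x t hxt).1, (hd t y hty).1]

theorem isPtolemaic_of_mem_Icc {X : Type u} {d : X → X → ℝ} {c : ℝ} (hc : c * c ≤ 2)
    (h0 : ∀ x, d x x = 0) (hsymm : ∀ x y, d x y = d y x)
    (hd : ∀ x y, x ≠ y → d x y ∈ Icc 1 c) : IsPtolemaic d := by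
  have hpos : ∀ x y, 0 ≤ d x y := fun x y => by
    rcases eq_or_ne x y with rfl | h
    · exact (h0 x).ge
    · linarith [(hd x y h).1]
  intro x y z t
  rcases eq_or_ne x y with rfl | hxy
  · rw [h0, zero_mul]
    exact add_nonneg (mul_nonneg (hpos _ _) (hpos _ _)) (mul_nonneg (hpos _ _) (hpos _ _))
  rcases eq_or_ne z t with rfl | hzt
  · rw [h0, mul_zero]
    exact add_nonneg (mul_nonneg (hpos _ _) (hpos _ _)) (mul_nonneg (hpos _ _) (hpos _ _))
  rcases eq_or_ne x z with rfl | hxz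
  · rw [h0, hsymm y x]
    linarith
  rcases eq_or_ne y t with rfl | hyt
  · rw [h0, hsymm z y]
    linarith
  rcases eq_or_ne x t with rfl | hxt
  · rw [h0, hsymm z x, hsymm y x]
    linarith
  rcases eq_or_ne y z with rfl | hyz
  · rw [h0]
    linarith
  have h₁ : d x y * d z t ≤ c * c :=
    mul_le_mul (hd x y hxy).2 (hd z t hzt).2 (hpos _ _) ((hpos x y).trans (hd x y hxy).2)
  have h₂ := one_le_mul_of_one_le_of_one_le (hd x z hxz).1 (hd y t hyt).1
  have h₃ := one_le_mul_of_one_le_of_one_le (hd x t hxt).1 (hd y z hyz).1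
  linarith

theorem combSim_comp {X : Type u} {A : Type w} {B : Type z} {Φ : X → X → A} {f : A → B}
    (hf : Set.InjOn f (range2 Φ)) : CombSim Φ fun x y => f (Φ x y) := by
  refine ⟨id, f, Function.bijective_id, ⟨?_, hf, ?_⟩, fun _ _ => rfl⟩
  · rintro _ ⟨x, y, rfl⟩
    exact ⟨x, y, rfl⟩
  · rintro _ ⟨x, y, rfl⟩
    exact ⟨_, ⟨x, y, rfl⟩, rfl⟩

theorem exists_stronglyRigid_ptolemaic_of_injective_off_diagonal {X : Type u} {A : Type w}
    {Φ : X → X → A} (hsymm : ∀ x y, Φ x y = Φ y x)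
    (hcard : Cardinal.mk (range2 Φ) ≤ Cardinal.continuum) {a₀ : A}
    (hfib : fiber Φ a₀ = Set.diagonal X)
    (hinj : ∀ x y u v, Φ x y = Φ u v → Φ x y ≠ a₀ → (x = u ∧ y = v) ∨ (x = v ∧ y = u)) :
    ∃ d : X → X → ℝ, IsMetric d ∧ IsStronglyRigidMetric d ∧ IsPtolemaic d ∧ CombSim Φ d := by
  classical
  obtain ⟨j, hj, hmem⟩ := exists_injOn_mem_Ioo hcard (show (1 : ℝ) < 7 / 5 by norm_num)
  have hdiag : ∀ x y, Φ x y = a₀ ↔ x = y := fun x y => Set.ext_iff.1 hfib (x, y)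
  have hjpos : ∀ a, j a ≠ 0 := fun a => (zero_lt_one.trans (hmem a).1).ne'
  let f : A → ℝ := fun a => if a = a₀ then 0 else j a
  have hf : Set.InjOn f (range2 Φ) := by
    intro a ha b hb hab
    simp only [f] at hab
    split_ifs at hab with h₁ h₂ h₂
    · exact h₁.trans h₂.symm
    · exact absurd hab.symm (hjpos b)
    · exact absurd hab (hjpos a)
    · exact hj ha hb hab
  have hd0 : ∀ x, f (Φ x x) = 0 := fun x => if_pos ((hdiag x x).2 rfl)
  have hds : ∀ x y, f (Φ x y) = f (Φ y x) := fun x y => congrArg f (hsymm x y)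
  have hd : ∀ x y, x ≠ y → f (Φ x y) ∈ Icc (1 : ℝ) (7 / 5) := fun x y hxy => by
    simp only [f, if_neg (mt (hdiag x y).1 hxy)]
    exact Ioo_subset_Icc_self (hmem _)
  refine ⟨fun x y => f (Φ x y), isMetric_of_mem_Icc hd0 hds fun x y hxy =>
    Icc_subset_Icc_right (by norm_num) (hd x y hxy), fun x y u v h hne => ?_,
    isPtolemaic_of_mem_Icc (by norm_num) hd0 hds hd, combSim_comp hf⟩
  exact hinj x y u v (hf ⟨x, y, rfl⟩ ⟨u, v, rfl⟩ h) fun h₀ => hne (if_pos h₀)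

/-- Corollary 4.5: for a mapping `Φ` with domain `X²` the following are equivalent:
(1) `Φ` is combinatorially similar to a strongly rigid Ptolemaic metric on `X`;
(2) `Φ` is combinatorially similar to a strongly rigid metric on `X`;
(3) `Φ` is symmetric, `|Φ(X²)| ≤ 𝔠`, there is `a₀ ∈ Φ(X²)` with `Φ⁻¹(a₀) = Δ_X`, and
`Φ(x,y) = Φ(u,v) ≠ a₀` implies `(x = u ∧ y = v) ∨ (x = v ∧ y = u)`. -/
theorem combSim_stronglyRigid_metric_tfae {X : Type u} {A : Type w} [Nonempty X]
    (Φ : X → X → A) :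
    ((∃ d : X → X → ℝ, IsMetric d ∧ IsStronglyRigidMetric d ∧ IsPtolemaic d ∧
        CombSim Φ d) ↔
      (∃ d : X → X → ℝ, IsMetric d ∧ IsStronglyRigidMetric d ∧ CombSim Φ d)) ∧
    ((∃ d : X → X → ℝ, IsMetric d ∧ IsStronglyRigidMetric d ∧ CombSim Φ d) ↔
      ((∀ x y, Φ x y = Φ y x) ∧ Cardinal.mk (range2 Φ) ≤ Cardinal.continuum ∧
        ∃ a₀ ∈ range2 Φ, fiber Φ a₀ = Set.diagonal X ∧
          ∀ x y uu vv, Φ x y = Φ uu vv → Φ x y ≠ a₀ →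
            (x = uu ∧ y = vv) ∨ (x = vv ∧ y = uu))) := by
  have h₁₂ : (∃ d : X → X → ℝ, IsMetric d ∧ IsStronglyRigidMetric d ∧ IsPtolemaic d ∧
      CombSim Φ d) → ∃ d : X → X → ℝ, IsMetric d ∧ IsStronglyRigidMetric d ∧ CombSim Φ d :=
    fun ⟨d, hm, hr, _, hs⟩ => ⟨d, hm, hr, hs⟩
  have h₂₃ : (∃ d : X → X → ℝ, IsMetric d ∧ IsStronglyRigidMetric d ∧ CombSim Φ d) →
      (∀ x y, Φ x y = Φ y x) ∧ Cardinal.mk (range2 Φ) ≤ Cardinal.continuum ∧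
        ∃ a₀ ∈ range2 Φ, fiber Φ a₀ = Set.diagonal X ∧
          ∀ x y uu vv, Φ x y = Φ uu vv → Φ x y ≠ a₀ →
            (x = uu ∧ y = vv) ∨ (x = vv ∧ y = uu) := by
    rintro ⟨d, ⟨-, hzero, hsymm, -⟩, hrigid, hsim⟩
    obtain ⟨e, he⟩ := hsim.exists_equiv
    let p : X := Classical.arbitrary X
    have hp : d (e p) (e p) = 0 := (hzero _ _).2 rfl
    refine ⟨fun x y => (he x y y x).2 (hsymm _ _), hsim.mk_range2_le_continuum,
      Φ p p, ⟨p, p, rfl⟩, ?_, fun x y u v h hne => ?_⟩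
    · ext ⟨x, y⟩
      change Φ x y = Φ p p ↔ x = y
      rw [he, hp, hzero, e.injective.eq_iff]
    · have hne' : d (e x) (e y) ≠ 0 := fun h₀ => hne ((he x y p p).2 (h₀.trans hp.symm))
      simpa using hrigid _ _ _ _ ((he x y u v).1 h) hne'
  have h₃₁ : ((∀ x y, Φ x y = Φ y x) ∧ Cardinal.mk (range2 Φ) ≤ Cardinal.continuum ∧
        ∃ a₀ ∈ range2 Φ, fiber Φ a₀ = Set.diagonal X ∧
          ∀ x y uu vv, Φ x y = Φ uu vv → Φ x y ≠ a₀ →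
            (x = uu ∧ y = vv) ∨ (x = vv ∧ y = uu)) →
      ∃ d : X → X → ℝ, IsMetric d ∧ IsStronglyRigidMetric d ∧ IsPtolemaic d ∧ CombSim Φ d :=
    fun ⟨hsymm, hcard, _, _, hfib, hinj⟩ =>
      exists_stronglyRigid_ptolemaic_of_injective_off_diagonal hsymm hcard hfib hinj
  exact ⟨⟨h₁₂, h₃₁ ∘ h₂₃⟩, h₂₃, h₁₂ ∘ h₃₁⟩
end

section
/- Let (H,*) be a semigroup. The following conditions are equivalent: (1) there are a nonempty set X and a discrete pseudometric d : X² → ℝ such that (H,*) is isomorphic to B_X(P_{d⁻¹}); (2) exactly one of the following three conditions holds: (a) (H,*) is a trivial (one-element) group; (b) (H,*) is a group of order 2; (c) (H,*) is obtained by adjunction of an identity element to a null semigroup of order 2, i.e., H has exactly three elements e, a, θ, where e is an identity element, θ is a zero element, and a*a = θ. -/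
open Set

universe u v w z

noncomputable instance relSemigroup {X : Type u} : Semigroup (Set (X × X)) where
  mul R T := {p : X × X | ∃ zz, (p.1, zz) ∈ R ∧ (zz, p.2) ∈ T}
  mul_assoc R S T := by
    ext p
    constructor
    · rintro ⟨a, ⟨b, h1, h2⟩, h3⟩
      exact ⟨b, h1, a, h2, h3⟩
    · rintro ⟨b, h1, a, h2, h3⟩
      exact ⟨a, ⟨b, h1, h2⟩, h3⟩

def IsDiscretePseudometric {X : Type u} (d : X → X → ℝ) : Prop :=
  IsPseudometric d ∧ Cardinal.mk (range2 d) ≤ 2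

/-- `H` is a trivial (one-element) group. -/
def IsTrivialGroupSG (H : Type u) [Semigroup H] : Prop :=
  ∃ e : H, ∀ x : H, x = e

/-- `H` is a group of order `2`: it has exactly two elements `e ≠ a`, where `e` is an
identity element and `a * a = e`. -/
def IsGroupOfOrderTwoSG (H : Type u) [Semigroup H] : Prop :=
  ∃ e a : H, e ≠ a ∧ (∀ x : H, x = e ∨ x = a) ∧
    (∀ x : H, e * x = x ∧ x * e = x) ∧ a * a = e

/-- `H` is obtained by adjunction of an identity element to a null semigroup of order
`2`: it has exactly three elements `e`, `a`, `θ`, where `e` is an identity element, `θ`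
is a zero element and `a * a = θ`. -/
def IsNullTwoWithIdentitySG (H : Type u) [Semigroup H] : Prop :=
  ∃ e a θ : H, e ≠ a ∧ a ≠ θ ∧ e ≠ θ ∧ (∀ x : H, x = e ∨ x = a ∨ x = θ) ∧
    (∀ x : H, e * x = x ∧ x * e = x) ∧ (∀ x : H, θ * x = θ ∧ x * θ = θ) ∧ a * a = θ

theorem mem_rel_mul {X : Type u} (R T : Set (X × X)) (x y : X) :
    (x, y) ∈ R * T ↔ ∃ z, (x, z) ∈ R ∧ (z, y) ∈ T := Iff.rfl

theorem mem_fiber_iff {X : Type u} {A : Type w} (Φ : X → X → A) (a : A) (x y : X) :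
    (x, y) ∈ fiber Φ a ↔ Φ x y = a := Iff.rfl

section Isomorphism

variable {H : Type u} {K : Type v} [Semigroup H] [Semigroup K]

theorem IsTrivialGroupSG.of_mulEquiv (φ : K ≃* H) (h : IsTrivialGroupSG K) :
    IsTrivialGroupSG H := by
  obtain ⟨e, he⟩ := h
  exact ⟨φ e, fun x => by rw [← he (φ.symm x), φ.apply_symm_apply]⟩

theorem IsGroupOfOrderTwoSG.of_mulEquiv (φ : K ≃* H) (h : IsGroupOfOrderTwoSG K) :
    IsGroupOfOrderTwoSG H := by
  obtain ⟨e, a, hea, hall, hid, haa⟩ := h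
  refine ⟨φ e, φ a, φ.injective.ne hea, fun x => ?_, fun x => ?_, by rw [← map_mul, haa]⟩
  · obtain ⟨y, rfl⟩ := φ.surjective x
    simpa using hall y
  · obtain ⟨y, rfl⟩ := φ.surjective x
    simpa [← map_mul] using hid y

theorem IsNullTwoWithIdentitySG.of_mulEquiv (φ : K ≃* H) (h : IsNullTwoWithIdentitySG K) :
    IsNullTwoWithIdentitySG H := by
  obtain ⟨e, a, θ, hea, haθ, heθ, hall, hid, hz, haa⟩ := h
  refine ⟨φ e, φ a, φ θ, φ.injective.ne hea, φ.injective.ne haθ, φ.injective.ne heθ,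
    fun x => ?_, fun x => ?_, fun x => ?_, by rw [← map_mul, haa]⟩
  · obtain ⟨y, rfl⟩ := φ.surjective x
    simpa using hall y
  · obtain ⟨y, rfl⟩ := φ.surjective x
    simpa [← map_mul] using hid y
  · obtain ⟨y, rfl⟩ := φ.surjective x
    simpa [← map_mul] using hz y

theorem IsTrivialGroupSG.nonempty_mulEquiv (hH : IsTrivialGroupSG H)
    (hK : IsTrivialGroupSG K) : Nonempty (H ≃* K) := by
  obtain ⟨e, he⟩ := hH
  obtain ⟨e', he'⟩ := hK
  exact ⟨{ toFun := fun _ => e'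
           invFun := fun _ => e
           left_inv := fun x => (he x).symm
           right_inv := fun x => (he' x).symm
           map_mul' := fun _ _ => (he' _).symm }⟩

open Classical in
theorem IsGroupOfOrderTwoSG.nonempty_mulEquiv (hH : IsGroupOfOrderTwoSG H)
    (hK : IsGroupOfOrderTwoSG K) : Nonempty (H ≃* K) := by
  obtain ⟨e, a, hea, hall, hid, haa⟩ := hH
  obtain ⟨e', a', hea', hall', hid', haa'⟩ := hK
  refine ⟨{ toFun := fun x => if x = e then e' else a'
            invFun := fun x => if x = e' then e else a
            left_inv := fun x => ?_
            right_inv := fun x => ?_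
            map_mul' := fun x y => ?_ }⟩
  · rcases hall x with rfl | rfl <;> simp [hea.symm, hea'.symm]
  · rcases hall' x with rfl | rfl <;> simp [hea.symm, hea'.symm]
  · rcases hall x with rfl | rfl <;> rcases hall y with rfl | rfl <;>
      simp [hid, hid', haa, haa', hea.symm]

open Classical in
theorem IsNullTwoWithIdentitySG.nonempty_mulEquiv (hH : IsNullTwoWithIdentitySG H)
    (hK : IsNullTwoWithIdentitySG K) : Nonempty (H ≃* K) := by
  obtain ⟨e, a, θ, hea, haθ, heθ, hall, hid, hz, haa⟩ := hH
  obtain ⟨e', a', θ', hea', haθ', heθ', hall', hid', hz', haa'⟩ := hK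
  refine ⟨{ toFun := fun x => if x = e then e' else if x = a then a' else θ'
            invFun := fun x => if x = e' then e else if x = a' then a else θ
            left_inv := fun x => ?_
            right_inv := fun x => ?_
            map_mul' := fun x y => ?_ }⟩
  · rcases hall x with rfl | rfl | rfl <;>
      simp [hea.symm, hea'.symm, haθ.symm, haθ'.symm, heθ.symm, heθ'.symm]
  · rcases hall' x with rfl | rfl | rfl <;>
      simp [hea.symm, hea'.symm, haθ.symm, haθ'.symm, heθ.symm, heθ'.symm]
  · rcases hall x with rfl | rfl | rfl <;> rcases hall y with rfl | rfl | rfl <;>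
      simp [hid, hid', hz, hz', haa, haa', hea.symm, haθ.symm, heθ.symm]

end Isomorphism

section Exclusive

variable {H : Type u} [Semigroup H]

theorem IsTrivialGroupSG.not_isGroupOfOrderTwoSG (h : IsTrivialGroupSG H) :
    ¬IsGroupOfOrderTwoSG H := by
  obtain ⟨e, he⟩ := h
  rintro ⟨e', a, hea, -⟩
  exact hea ((he e').trans (he a).symm)

theorem IsTrivialGroupSG.not_isNullTwoWithIdentitySG (h : IsTrivialGroupSG H) :
    ¬IsNullTwoWithIdentitySG H := by
  obtain ⟨e, he⟩ := h
  rintro ⟨e', a, θ, hea, -⟩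
  exact hea ((he e').trans (he a).symm)

theorem IsGroupOfOrderTwoSG.not_isNullTwoWithIdentitySG (h : IsGroupOfOrderTwoSG H) :
    ¬IsNullTwoWithIdentitySG H := by
  obtain ⟨e, a, -, hall, -⟩ := h
  rintro ⟨e', a', θ, hea, haθ, heθ, -⟩
  have h₁ := hall e'
  have h₂ := hall a'
  have h₃ := hall θ
  grind

end Exclusive

section Fibers

variable {X : Type u} {d : X → X → ℝ}

theorem isTrivialGroupSG_closure_fibers [Nonempty X] (h0 : ∀ x y, d x y = 0) :
    IsTrivialGroupSG (Subsemigroup.closure (fibers d)) := by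
  obtain ⟨x₀⟩ := ‹Nonempty X›
  refine ⟨⟨univ, Subsemigroup.subset_closure
    ⟨0, ⟨x₀, x₀, h0 _ _⟩, by ext ⟨x, y⟩; simp [mem_fiber_iff, h0]⟩⟩, ?_⟩
  rintro ⟨R, hR⟩
  apply Subtype.ext
  change R = univ
  induction hR using Subsemigroup.closure_induction with
  | mem R hR =>
    obtain ⟨a, ⟨x, y, rfl⟩, rfl⟩ := hR
    ext ⟨x, y⟩
    simp [mem_fiber_iff, h0]
  | mul R T _ _ hR hT =>
    subst hR hT
    ext ⟨x, y⟩
    simp [mem_rel_mul]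

theorem IsPseudometric.eq_of_zero_left (hd : IsPseudometric d) {x y : X} (h : d x y = 0)
    (z : X) : d x z = d y z := by
  obtain ⟨-, hs, -, ht⟩ := hd
  have h₁ := ht x z y
  have h₂ := ht y z x
  have h₃ := hs x y
  linarith

theorem IsPseudometric.eq_of_zero_right (hd : IsPseudometric d) {x y : X} (h : d x y = 0)
    (z : X) : d z x = d z y := by
  rw [hd.2.1 z x, hd.2.1 z y, hd.eq_of_zero_left h]

theorem IsPseudometric.fiber_zero_mul_fiber (hd : IsPseudometric d) (a : ℝ) :
    fiber d 0 * fiber d a = fiber d a := by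
  ext ⟨x, y⟩
  simp only [mem_rel_mul, mem_fiber_iff]
  constructor
  · rintro ⟨z, hz, rfl⟩
    exact hd.eq_of_zero_left hz y
  · exact fun h => ⟨x, hd.2.2.1 x, h⟩

theorem IsPseudometric.fiber_mul_fiber_zero (hd : IsPseudometric d) (a : ℝ) :
    fiber d a * fiber d 0 = fiber d a := by
  ext ⟨x, y⟩
  simp only [mem_rel_mul, mem_fiber_iff]
  constructor
  · rintro ⟨z, rfl, hz⟩
    exact (hd.eq_of_zero_right hz x).symm
  · exact fun h => ⟨y, h, hd.2.2.1 y⟩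

theorem isGroupOfOrderTwoSG_closure_fibers (hd : IsPseudometric d) {x₀ y₀ : X}
    (hc : d x₀ y₀ ≠ 0) (hval : ∀ x y, d x y = 0 ∨ d x y = d x₀ y₀)
    (htwo : ∀ z, d x₀ z = 0 ∨ d y₀ z = 0) :
    IsGroupOfOrderTwoSG (Subsemigroup.closure (fibers d)) := by
  set c := d x₀ y₀ with hcdef
  have hE : fiber d 0 ∈ Subsemigroup.closure (fibers d) :=
    Subsemigroup.subset_closure ⟨0, ⟨x₀, x₀, hd.2.2.1 _⟩, rfl⟩
  have hA : fiber d c ∈ Subsemigroup.closure (fibers d) :=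
    Subsemigroup.subset_closure ⟨c, ⟨x₀, y₀, rfl⟩, rfl⟩
  have hAA : fiber d c * fiber d c = fiber d 0 := by
    ext ⟨x, y⟩
    simp only [mem_rel_mul, mem_fiber_iff]
    constructor
    · rintro ⟨z, h₁, h₂⟩
      have s := hd.2.1
      rcases htwo x with hx | hx <;> rcases htwo y with hy | hy <;>
        rcases htwo z with hz | hz <;>
        have k₁ := hd.eq_of_zero_left hx <;> have k₂ := hd.eq_of_zero_left hy <;>
        have k₃ := hd.eq_of_zero_left hz <;> grind
    · intro h
      have s := hd.2.1
      rcases htwo x with hx | hx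
      · refine ⟨y₀, ?_, ?_⟩
        · rw [← hd.eq_of_zero_left hx]
        · rw [← hd.eq_of_zero_right h, s, ← hd.eq_of_zero_left hx]
      · refine ⟨x₀, ?_, ?_⟩
        · rw [← hd.eq_of_zero_left hx, s]
        · rw [← hd.eq_of_zero_right h, s, ← hd.eq_of_zero_left hx, s]
  have hall : ∀ R ∈ Subsemigroup.closure (fibers d), R = fiber d 0 ∨ R = fiber d c := by
    intro R hR
    induction hR using Subsemigroup.closure_induction with
    | mem R hR =>
      obtain ⟨a, ⟨x, y, rfl⟩, rfl⟩ := hR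
      rcases hval x y with h | h <;> simp [h]
    | mul R T _ _ hR hT =>
      rcases hR with rfl | rfl <;> rcases hT with rfl | rfl <;>
        simp [hd.fiber_zero_mul_fiber, hd.fiber_mul_fiber_zero, hAA]
  refine ⟨⟨_, hE⟩, ⟨_, hA⟩, fun h => ?_, ?_, ?_, Subtype.ext hAA⟩
  · have h' : (x₀, y₀) ∈ fiber d 0 := by
      rw [Subtype.mk.inj h]
      rfl
    exact hc h'
  · rintro ⟨R, hR⟩
    simpa using hall R hR
  · rintro ⟨R, hR⟩
    rcases hall R hR with rfl | rfl <;>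
      simp [hd.fiber_zero_mul_fiber, hd.fiber_mul_fiber_zero]

theorem isNullTwoWithIdentitySG_closure_fibers (hd : IsPseudometric d) {x₀ y₀ z₀ : X}
    (hc : d x₀ y₀ ≠ 0) (hval : ∀ x y, d x y = 0 ∨ d x y = d x₀ y₀)
    (hxz : d x₀ z₀ ≠ 0) (hyz : d y₀ z₀ ≠ 0) :
    IsNullTwoWithIdentitySG (Subsemigroup.closure (fibers d)) := by
  set c := d x₀ y₀ with hcdef
  have hE : fiber d 0 ∈ Subsemigroup.closure (fibers d) :=
    Subsemigroup.subset_closure ⟨0, ⟨x₀, x₀, hd.2.2.1 _⟩, rfl⟩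
  have hA : fiber d c ∈ Subsemigroup.closure (fibers d) :=
    Subsemigroup.subset_closure ⟨c, ⟨x₀, y₀, rfl⟩, rfl⟩
  have hne : ∀ x y, d x y ≠ 0 → d x y = c := fun x y h => (hval x y).resolve_left h
  have hs := hd.2.1
  have hfar : ∀ x, ∃ z, d x z = c := by
    intro x
    by_cases hx : d x x₀ = 0
    · exact ⟨y₀, hd.eq_of_zero_left hx y₀⟩
    · exact ⟨x₀, hne _ _ hx⟩
  have hAA : fiber d c * fiber d c = univ := by
    ext ⟨x, y⟩
    simp only [mem_rel_mul, mem_fiber_iff, mem_univ, iff_true]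
    by_contra! hcon
    have near : ∀ z, d x z = 0 ∨ d y z = 0 := fun z => by
      by_contra! h
      exact hcon z (hne _ _ h.1) (hne _ _ (hs y z ▸ h.2))
    have sep : ∀ w p q, d p q ≠ 0 → d w p = 0 → d w q ≠ 0 := fun w p q hpq hp hq =>
      hpq ((hd.eq_of_zero_left hp q).symm.trans hq)
    rcases near x₀ with h₁ | h₁ <;> rcases near y₀ with h₂ | h₂ <;>
      rcases near z₀ with h₃ | h₃ <;>
      first
        | exact sep _ _ _ hc h₁ h₂
        | exact sep _ _ _ hxz h₁ h₃
        | exact sep _ _ _ hyz h₂ h₃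
  have hUE : univ * fiber d 0 = univ := by
    rw [← hAA, mul_assoc, hd.fiber_mul_fiber_zero]
  have hEU : fiber d 0 * univ = univ := by
    rw [← hAA, ← mul_assoc, hd.fiber_zero_mul_fiber]
  have hUA : univ * fiber d c = univ := by
    ext ⟨x, y⟩
    obtain ⟨z, hz⟩ := hfar y
    simpa [mem_rel_mul, mem_fiber_iff] using ⟨z, (hs z y).trans hz⟩
  have hAU : fiber d c * univ = univ := by
    ext ⟨x, y⟩
    simpa [mem_rel_mul, mem_fiber_iff] using hfar x
  have hUU : (univ : Set (X × X)) * univ = univ := by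
    ext ⟨x, y⟩
    simp [mem_rel_mul, Nonempty.intro x]
  have hU : univ ∈ Subsemigroup.closure (fibers d) := hAA ▸ mul_mem hA hA
  have hall : ∀ R ∈ Subsemigroup.closure (fibers d),
      R = fiber d 0 ∨ R = fiber d c ∨ R = univ := by
    intro R hR
    induction hR using Subsemigroup.closure_induction with
    | mem R hR =>
      obtain ⟨a, ⟨x, y, rfl⟩, rfl⟩ := hR
      rcases hval x y with h | h <;> simp [h]
    | mul R T _ _ hR hT =>
      rcases hR with rfl | rfl | rfl <;> rcases hT with rfl | rfl | rfl <;>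
        simp [hd.fiber_zero_mul_fiber, hd.fiber_mul_fiber_zero, hAA, hUE, hEU, hUA, hAU, hUU]
  have hxyA : (x₀, y₀) ∈ fiber d c := rfl
  have hxyE : (x₀, y₀) ∉ fiber d 0 := hc
  have hxxA : (x₀, x₀) ∉ fiber d c := fun h => hc (h.symm.trans (hd.2.2.1 x₀))
  refine ⟨⟨_, hE⟩, ⟨_, hA⟩, ⟨_, hU⟩, fun h => ?_, fun h => ?_, fun h => ?_, ?_, ?_, ?_,
    Subtype.ext hAA⟩
  · exact hxyE (Subtype.mk.inj h ▸ hxyA)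
  · exact hxxA (Subtype.mk.inj h ▸ mem_univ _)
  · exact hxyE (Subtype.mk.inj h ▸ mem_univ _)
  · rintro ⟨R, hR⟩
    simpa using hall R hR
  · rintro ⟨R, hR⟩
    rcases hall R hR with rfl | rfl | rfl <;>
      simp [hd.fiber_zero_mul_fiber, hd.fiber_mul_fiber_zero, hUE, hEU]
  · rintro ⟨R, hR⟩
    rcases hall R hR with rfl | rfl | rfl <;>
      simp [hUE, hEU, hUA, hAU, hUU]

theorem IsDiscretePseudometric.eq_zero_or_eq (hd : IsDiscretePseudometric d) {x₀ y₀ : X}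
    (hc : d x₀ y₀ ≠ 0) (x y : X) : d x y = 0 ∨ d x y = d x₀ y₀ := by
  by_contra! h
  have hsub : (({0, d x₀ y₀, d x y} : Finset ℝ) : Set ℝ) ⊆ range2 d := by
    intro a ha
    simp only [Finset.coe_insert, Finset.coe_singleton, mem_insert_iff,
      mem_singleton_iff] at ha
    rcases ha with rfl | rfl | rfl
    exacts [⟨x₀, x₀, hd.1.2.2.1 _⟩, ⟨_, _, rfl⟩, ⟨_, _, rfl⟩]
  have hcard : ({0, d x₀ y₀, d x y} : Finset ℝ).card = 3 :=
    Finset.card_eq_three.2 ⟨_, _, _, hc.symm, h.1.symm, h.2.symm, rfl⟩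
  have hle := Cardinal.mk_coe_finset.symm.le.trans
    ((Cardinal.mk_le_mk_of_subset hsub).trans hd.2)
  rw [hcard] at hle
  exact absurd (by exact_mod_cast hle : (3 : ℕ) ≤ 2) (by norm_num)

theorem IsDiscretePseudometric.closure_fibers_cases [Nonempty X]
    (hd : IsDiscretePseudometric d) :
    IsTrivialGroupSG (Subsemigroup.closure (fibers d)) ∨
      IsGroupOfOrderTwoSG (Subsemigroup.closure (fibers d)) ∨
      IsNullTwoWithIdentitySG (Subsemigroup.closure (fibers d)) := by
  by_cases h0 : ∀ x y, d x y = 0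
  · exact Or.inl (isTrivialGroupSG_closure_fibers h0)
  push Not at h0
  obtain ⟨x₀, y₀, hc⟩ := h0
  by_cases htwo : ∀ z, d x₀ z = 0 ∨ d y₀ z = 0
  · exact Or.inr (Or.inl (isGroupOfOrderTwoSG_closure_fibers hd.1 hc (hd.eq_zero_or_eq hc) htwo))
  push Not at htwo
  obtain ⟨z₀, hxz, hyz⟩ := htwo
  exact Or.inr (Or.inr
    (isNullTwoWithIdentitySG_closure_fibers hd.1 hc (hd.eq_zero_or_eq hc) hxz hyz))

end Fibers

open Classical in
/-- The metric on `X` taking the value `1` at every pair of distinct points. -/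
noncomputable def discreteDist (X : Type u) (x y : X) : ℝ := if x = y then 0 else 1

theorem isDiscretePseudometric_discreteDist (X : Type u) :
    IsDiscretePseudometric (discreteDist X) := by
  refine ⟨⟨fun x y => ?_, fun x y => ?_, fun x => ?_, fun x y z => ?_⟩, ?_⟩
  · unfold discreteDist
    split_ifs <;> norm_num
  · unfold discreteDist
    split_ifs <;> grind
  · simp [discreteDist]
  · unfold discreteDist
    split_ifs <;> grind
  · have hsub : range2 (discreteDist X) ⊆ (({0, 1} : Finset ℝ) : Set ℝ) := by
      rintro _ ⟨x, y, rfl⟩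
      unfold discreteDist
      split_ifs <;> simp
    refine (Cardinal.mk_le_mk_of_subset hsub).trans (Cardinal.mk_coe_finset.le.trans ?_)
    exact_mod_cast Finset.card_le_two

theorem discreteDist_ne_zero {X : Type u} {x y : X} (h : x ≠ y) : discreteDist X x y ≠ 0 := by
  simp [discreteDist, h]

/-- Proposition 4.22: a semigroup `(H,*)` is isomorphic to `B_X(P_{d⁻¹})` for some
nonempty set `X` and discrete pseudometric `d` on `X` iff exactly one of the following
holds: `(H,*)` is a trivial group, or a group of order `2`, or is obtained by adjoining
an identity element to a null semigroup of order `2`. -/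
theorem discrete_pseudometric_fiber_semigroup_characterization
    (H : Type u) [Semigroup H] :
    (∃ (X : Type v) (_ : Nonempty X) (d : X → X → ℝ), IsDiscretePseudometric d ∧
      Nonempty (H ≃* (Subsemigroup.closure (fibers d)))) ↔
    ((IsTrivialGroupSG H ∧ ¬IsGroupOfOrderTwoSG H ∧ ¬IsNullTwoWithIdentitySG H) ∨
     (¬IsTrivialGroupSG H ∧ IsGroupOfOrderTwoSG H ∧ ¬IsNullTwoWithIdentitySG H) ∨
     (¬IsTrivialGroupSG H ∧ ¬IsGroupOfOrderTwoSG H ∧ IsNullTwoWithIdentitySG H)) := by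
  constructor
  · rintro ⟨X, _, d, hd, ⟨φ⟩⟩
    rcases hd.closure_fibers_cases with h | h | h
    · have h' := h.of_mulEquiv φ.symm
      exact Or.inl ⟨h', h'.not_isGroupOfOrderTwoSG, h'.not_isNullTwoWithIdentitySG⟩
    · have h' := h.of_mulEquiv φ.symm
      exact Or.inr (Or.inl ⟨fun ht => ht.not_isGroupOfOrderTwoSG h', h',
        h'.not_isNullTwoWithIdentitySG⟩)
    · have h' := h.of_mulEquiv φ.symm
      exact Or.inr (Or.inr ⟨fun ht => ht.not_isNullTwoWithIdentitySG h',
        fun ht => ht.not_isNullTwoWithIdentitySG h', h'⟩)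
  · rintro (⟨h, -, -⟩ | ⟨-, h, -⟩ | ⟨-, -, h⟩)
    · refine ⟨PUnit, inferInstance, discreteDist _, isDiscretePseudometric_discreteDist _,
        h.nonempty_mulEquiv (isTrivialGroupSG_closure_fibers fun x y => ?_)⟩
      simp [discreteDist]
    · have hd := isDiscretePseudometric_discreteDist (ULift.{v} (Fin 2))
      have hc := discreteDist_ne_zero (X := ULift.{v} (Fin 2)) (x := ⟨0⟩) (y := ⟨1⟩) (by simp)
      refine ⟨_, inferInstance, _, hd, h.nonempty_mulEquiv
        (isGroupOfOrderTwoSG_closure_fibers hd.1 hc (hd.eq_zero_or_eq hc) ?_)⟩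
      rintro ⟨z⟩
      fin_cases z <;> simp [discreteDist]
    · have hd := isDiscretePseudometric_discreteDist (ULift.{v} (Fin 3))
      have hc := discreteDist_ne_zero (X := ULift.{v} (Fin 3)) (x := ⟨0⟩) (y := ⟨1⟩) (by simp)
      exact ⟨_, inferInstance, _, hd, h.nonempty_mulEquiv
        (isNullTwoWithIdentitySG_closure_fibers hd.1 (z₀ := ⟨2⟩) hc (hd.eq_zero_or_eq hc)
          (discreteDist_ne_zero (by simp)) (discreteDist_ne_zero (by simp)))⟩
end
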